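/- arXiv:1802.10333 — 4 statements merged into one kernel-verified Lean document; each statement's English description precedes it below -/
import Mathlib

section
/- Let β be a real number. Every sequence U : ℕ → ℂ satisfying the three-term recurrence U(n+1) = -U(n-1) + 2βU(n) for all n ≥ 1 grows at most linearly in n (i.e., there exists a constant C ≥ 0 with |U(n)| ≤ C(n+1) for all n) if and only if |β| ≤ 1. -/
/-- A geometric sequence with ratio greater than one is not bounded by a linear function. -/
theorem exists_linear_lt_pow {s : ℝ} (hs : 1 < s) (C : ℝ) : ∃ n : ℕ, C * (n + 1) < s ^ n := by
  obtain ⟨a, rfl⟩ : ∃ a, s = 1 + a := ⟨s - 1, by ring⟩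
  have ha : 0 < a := by linarith
  obtain ⟨n, hn⟩ := exists_nat_gt (max C ((2 * C + 1) / a ^ 2))
  have h₁ : C < n := (le_max_left _ _).trans_lt hn
  have h₂ : 2 * C + 1 < n * a ^ 2 :=
    (div_lt_iff₀ (by positivity)).1 ((le_max_right _ _).trans_lt hn)
  have bernoulli : 1 + n * a ≤ (1 + a) ^ n := one_add_mul_le_pow (by linarith) n
  have hna : 0 ≤ n * a := by positivity
  refine ⟨2 * n, ?_⟩
  calc C * ((2 * n : ℕ) + 1) = n * (2 * C + 1) + (C - n) := by push_cast; ring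
    _ ≤ n * (n * a ^ 2) + 0 := by gcongr; linarith
    _ < (1 + n * a) ^ 2 := by nlinarith
    _ ≤ ((1 + a) ^ n) ^ 2 := by gcongr
    _ = (1 + a) ^ (2 * n) := by rw [← pow_mul, mul_comm]

/-- For `|β| > 1` the characteristic polynomial `r ^ 2 - 2 β r + 1` has a real root of modulus
greater than one. -/
theorem exists_root_one_lt_abs {β : ℝ} (hβ : 1 < |β|) :
    ∃ r : ℝ, 1 < |r| ∧ r ^ 2 = -1 + 2 * β * r := by
  have hsq : √(β ^ 2 - 1) ^ 2 = β ^ 2 - 1 :=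
    Real.sq_sqrt (by nlinarith [sq_abs β])
  have hnn := Real.sqrt_nonneg (β ^ 2 - 1)
  rcases lt_abs.1 hβ with h | h
  · exact ⟨β + √(β ^ 2 - 1), lt_abs.2 (.inl (by linarith)), by linear_combination hsq⟩
  · exact ⟨β - √(β ^ 2 - 1), lt_abs.2 (.inr (by linarith)), by linear_combination hsq⟩

/-- A solution of a recurrence whose characteristic roots `z`, `w` lie in the closed unit disc
grows at most linearly. -/
theorem norm_le_of_recurrence {U : ℕ → ℂ} {z w : ℂ} (hz : ‖z‖ ≤ 1) (hw : ‖w‖ ≤ 1)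
    (hU : ∀ n, U (n + 2) = -(z * w) * U n + (z + w) * U (n + 1)) (n : ℕ) :
    ‖U n‖ ≤ ‖U 0‖ + n * ‖U 1 - z * U 0‖ := by
  have hD : ∀ n, ‖U (n + 1) - z * U n‖ ≤ ‖U 1 - z * U 0‖ := by
    intro n
    induction n with
    | zero => simp
    | succ k ih =>
      have : U (k + 2) - z * U (k + 1) = w * (U (k + 1) - z * U k) := by rw [hU]; ring
      rw [this, norm_mul]
      exact (mul_le_of_le_one_left (norm_nonneg _) hw).trans ih
  induction n with
  | zero => simp
  | succ k ih =>
    calc ‖U (k + 1)‖ = ‖(U (k + 1) - z * U k) + z * U k‖ := by rw [sub_add_cancel]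
      _ ≤ ‖U (k + 1) - z * U k‖ + ‖z‖ * ‖U k‖ := by
        rw [← norm_mul]; exact norm_add_le _ _
      _ ≤ ‖U 1 - z * U 0‖ + ‖U k‖ :=
        add_le_add (hD k) (mul_le_of_le_one_left (norm_nonneg _) hz)
      _ ≤ ‖U 0‖ + (k + 1 : ℕ) * ‖U 1 - z * U 0‖ := by push_cast; linarith

/-- For a real number `β`, every sequence `U : ℕ → ℂ` satisfying the
three-term recurrence `U (n+1) = -U (n-1) + 2 β U n` for all `n ≥ 1` grows at most
linearly (there is `C ≥ 0` with `‖U n‖ ≤ C (n+1)` for all `n`) if and only if `|β| ≤ 1`. -/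
theorem stmt0 (β : ℝ) :
    (∀ U : ℕ → ℂ, (∀ n : ℕ, 1 ≤ n → U (n + 1) = -U (n - 1) + 2 * (β : ℂ) * U n) →
      ∃ C : ℝ, 0 ≤ C ∧ ∀ n : ℕ, ‖U n‖ ≤ C * (n + 1)) ↔ |β| ≤ 1 := by
  constructor
  · intro h
    by_contra! hβ
    obtain ⟨r, hr, hroot⟩ := exists_root_one_lt_abs hβ
    obtain ⟨C, -, hC⟩ := h (fun n => (r : ℂ) ^ n) fun n hn => by
      obtain ⟨m, rfl⟩ := Nat.exists_eq_add_of_le' hn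
      have hroot' : (r : ℂ) ^ 2 = -1 + 2 * β * r := by exact_mod_cast hroot
      simp only [Nat.add_sub_cancel]
      linear_combination (r : ℂ) ^ m * hroot'
    obtain ⟨n, hn⟩ := exists_linear_lt_pow hr C
    refine (hC n).not_gt ?_
    simpa using hn
  · intro hβ U hU
    obtain ⟨hl, hu⟩ := abs_le.1 hβ
    set z := Complex.exp (Real.arccos β * Complex.I) with hz
    set w := Complex.exp (-(Real.arccos β) * Complex.I) with hw
    have hz1 : ‖z‖ = 1 := Complex.norm_exp_ofReal_mul_I _
    have hw1 : ‖w‖ = 1 := by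
      rw [hw, ← Complex.ofReal_neg]; exact Complex.norm_exp_ofReal_mul_I _
    have hmul : z * w = 1 := by rw [hz, hw, ← Complex.exp_add]; simp
    have hadd : z + w = 2 * β := by
      rw [hz, hw, ← Complex.two_cos, ← Complex.ofReal_cos, Real.cos_arccos hl hu]
    refine ⟨‖U 0‖ + ‖U 1 - z * U 0‖, by positivity, fun n => ?_⟩
    have hle := norm_le_of_recurrence (U := U) hz1.le hw1.le (fun k => by
      simpa [hmul, hadd] using hU (k + 1) (by omega)) n
    nlinarith [norm_nonneg (U 1 - z * U 0), mul_nonneg n.cast_nonneg (norm_nonneg (U 0))]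
end

section
/- Let β be a real number with |β| ≤ 1, and let U : ℕ → ℂ satisfy U(n+1) = -U(n-1) + 2βU(n) for all n ≥ 1. Then for all n, |U(n)| ≤ (2n+1)·max(|U(0)|, |U(1)|). -/
/-- A real number in `[-1, 1]` is the real part of a complex number of norm one. -/
theorem exists_norm_eq_one_add_conj_eq {β : ℝ} (hβ : |β| ≤ 1) :
    ∃ z : ℂ, ‖z‖ = 1 ∧ z + starRingEnd ℂ z = 2 * (β : ℂ) := by
  obtain ⟨h₁, h₂⟩ := abs_le.mp hβ
  refine ⟨Complex.exp (Real.arccos β * Complex.I), Complex.norm_exp_ofReal_mul_I _, ?_⟩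
  rw [Complex.add_conj, Complex.exp_ofReal_mul_I_re, Real.cos_arccos h₁ h₂]
  push_cast
  ring

/-- Factoring the recurrence through a characteristic root `z` of norm one: the sequence
`U (n + 1) - z * U n` is geometric with ratio `conj z`, so its norm is constant. -/
theorem norm_sub_mul_eq_of_recurrence {β z : ℂ} (hz : ‖z‖ = 1)
    (hsum : z + starRingEnd ℂ z = 2 * β) {U : ℕ → ℂ}
    (hU : ∀ n : ℕ, 1 ≤ n → U (n + 1) = -U (n - 1) + 2 * β * U n) (n : ℕ) :
    ‖U (n + 1) - z * U n‖ = ‖U 1 - z * U 0‖ := by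
  induction n with
  | zero => rfl
  | succ k ih =>
    have hprod : z * starRingEnd ℂ z = 1 := by simp [Complex.mul_conj', hz]
    have hstep : U (k + 1 + 1) - z * U (k + 1) = starRingEnd ℂ z * (U (k + 1) - z * U k) := by
      rw [hU (k + 1) (by lia), Nat.add_sub_cancel]
      linear_combination -U (k + 1) * hsum + U k * hprod
    rw [hstep, norm_mul, RCLike.norm_conj, hz, one_mul, ih]


/-- If `|β| ≤ 1` and `U : ℕ → ℂ` satisfies the three-term recurrence
`U (n+1) = -U (n-1) + 2 β U n` for all `n ≥ 1`, then `‖U n‖ ≤ (2n+1) · max ‖U 0‖ ‖U 1‖`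
for all `n`. -/
theorem stmt1 (β : ℝ) (hβ : |β| ≤ 1) (U : ℕ → ℂ)
    (hU : ∀ n : ℕ, 1 ≤ n → U (n + 1) = -U (n - 1) + 2 * (β : ℂ) * U n) (n : ℕ) :
    ‖U n‖ ≤ (2 * n + 1) * max ‖U 0‖ ‖U 1‖ := by
  obtain ⟨z, hz, hsum⟩ := exists_norm_eq_one_add_conj_eq hβ
  have hzU (k : ℕ) : ‖z * U k‖ = ‖U k‖ := by rw [norm_mul, hz, one_mul]
  have h₀ := le_max_left ‖U 0‖ ‖U 1‖
  have h₁ := le_max_right ‖U 0‖ ‖U 1‖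
  induction n with
  | zero => simp
  | succ k ih =>
    have hdiff := norm_sub_mul_eq_of_recurrence hz hsum hU k
    have hinit := norm_sub_le (U 1) (z * U 0)
    have htri := norm_le_norm_add_norm_sub (z * U k) (U (k + 1))
    rw [norm_sub_rev, hdiff, hzU] at htri
    rw [hzU] at hinit
    push_cast
    linarith
end

section
/- Let K ≥ 1 be an integer, let M and A be real symmetric positive definite n×n matrices, and let σ_max denote the largest eigenvalue of M⁻¹A (all eigenvalues of M⁻¹A are real and positive). Let c_K := inf{x ≥ 0 : |Σ_{k=0}^{K} (-x)^k/(2k)!| > 1}. Suppose Δt > 0 satisfies Δt² · σ_max ≤ c_K, and set B := Σ_{k=0}^{K} (Δt^{2k}/(2k)!)·(-M⁻¹A)^k. Then every sequence of vectors U : ℕ → ℝⁿ satisfying U(n+1) = -U(n-1) + 2B·U(n) for all n ≥ 1 grows at most linearly in time: there exists C ≥ 0 such that ‖U(n)‖ ≤ C(n+1) for all n. -/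
open Finset

/-- The three-term recurrence `y (m + 1) = -y (m - 1) + 2 b y m` with `|b| ≤ 1` grows at most
linearly. -/
theorem exists_linear_bound_of_recurrence {b : ℝ} (hb : |b| ≤ 1) {y : ℕ → ℝ}
    (hy : ∀ m : ℕ, 1 ≤ m → y (m + 1) = -y (m - 1) + 2 * b * y m) :
    ∃ C : ℝ, 0 ≤ C ∧ ∀ m : ℕ, |y m| ≤ C * (m + 1) := by
  set s := Real.sqrt (1 - b ^ 2)
  have hs : s ^ 2 = 1 - b ^ 2 := Real.sq_sqrt (by nlinarith [abs_le.mp hb])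
  have hconst : ∀ m : ℕ, (y (m + 1) - b * y m) ^ 2 + (s * y m) ^ 2 =
      (y 1 - b * y 0) ^ 2 + (s * y 0) ^ 2 := by
    intro m
    induction m with
    | zero => rfl
    | succ m ih =>
      have h := hy (m + 1) (by omega)
      simp only [Nat.add_sub_cancel] at h
      rw [← ih, h]
      linear_combination (y (m + 1) ^ 2 - y m ^ 2) * hs
  set E := (y 1 - b * y 0) ^ 2 + (s * y 0) ^ 2
  have hstep : ∀ m : ℕ, |y (m + 1)| ≤ |y m| + Real.sqrt E := by
    intro m
    have h1 : |y (m + 1) - b * y m| ≤ Real.sqrt E :=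
      Real.abs_le_sqrt (by nlinarith [hconst m, sq_nonneg (s * y m)])
    have h2 : |b * y m| ≤ |y m| := by
      rw [abs_mul]
      exact mul_le_of_le_one_left (abs_nonneg _) hb
    have h3 := abs_sub_abs_le_abs_sub (y (m + 1)) (b * y m)
    linarith
  refine ⟨|y 0| + Real.sqrt E, by positivity, fun m => ?_⟩
  induction m with
  | zero => simp
  | succ m ih =>
    have := hstep m
    have := abs_nonneg (y 0)
    push_cast
    nlinarith

/-- A continuous function is bounded by `c` on `[0, x₀]` as soon as `x₀` does not exceed the
infimum of the points of `[0, ∞)` where the bound fails and the bound holds at `0`. -/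
theorem abs_le_of_le_sInf {f : ℝ → ℝ} (hf : Continuous f) {c : ℝ} (h0 : |f 0| ≤ c) {x : ℝ}
    (hx0 : 0 ≤ x) (hx : x ≤ sInf {x : ℝ | 0 ≤ x ∧ c < |f x|}) : |f x| ≤ c := by
  rcases hx0.eq_or_lt with rfl | hpos
  · exact h0
  have hIco : Set.Ico 0 x ⊆ {t | |f t| ≤ c} := fun t ht => by
    by_contra hcon
    exact notMem_of_lt_csInf (ht.2.trans_le hx) ⟨0, fun z hz => hz.1⟩ ⟨ht.1, not_le.mp hcon⟩
  have hclosed : IsClosed {t | |f t| ≤ c} := isClosed_le hf.abs continuous_const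
  have := closure_minimal hIco hclosed
  rw [closure_Ico hpos.ne] at this
  exact this ⟨hx0, le_rfl⟩

open scoped MatrixOrder Matrix in
/-- The product of two real positive definite matrices is diagonalizable with positive
eigenvalues. -/
theorem exists_eq_units_conj_diagonal_of_posDef {ι : Type*} [Fintype ι] [DecidableEq ι]
    {N A : Matrix ι ι ℝ} (hN : N.PosDef) (hA : A.PosDef) :
    ∃ (P : (Matrix ι ι ℝ)ˣ) (d : ι → ℝ), (∀ i, 0 < d i) ∧
      N * A = P * Matrix.diagonal d * (↑P⁻¹ : Matrix ι ι ℝ) := by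
  obtain ⟨S, hS⟩ := CStarAlgebra.nonneg_iff_eq_star_mul_self.mp hN.posSemidef.nonneg
  have hSu : IsUnit S := by
    have h := hN.isUnit
    rw [hS, Matrix.isUnit_iff_isUnit_det, Matrix.det_mul] at h
    exact (Matrix.isUnit_iff_isUnit_det _).mpr (isUnit_of_mul_isUnit_right h)
  obtain ⟨T, rfl⟩ := hSu
  have hH : ((T : Matrix ι ι ℝ) * A * star (T : Matrix ι ι ℝ)).PosDef :=
    (Matrix.IsUnit.posDef_star_right_conjugate_iff T.isUnit).mpr hA
  obtain ⟨V, e, he, hspec⟩ : ∃ (V : Matrix.unitaryGroup ι ℝ) (e : ι → ℝ), (∀ i, 0 < e i) ∧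
      (T : Matrix ι ι ℝ) * A * star (T : Matrix ι ι ℝ) =
        (V : Matrix ι ι ℝ) * Matrix.diagonal e * star (V : Matrix ι ι ℝ) :=
    ⟨hH.1.eigenvectorUnitary, hH.1.eigenvalues, hH.eigenvalues_pos,
      hH.1.spectral_theorem.trans (Unitary.conjStarAlgAut_apply _ _)⟩
  refine ⟨star T * Unitary.toUnits V, e, he, ?_⟩
  have hinv : star (T : Matrix ι ι ℝ) * (↑(star T)⁻¹ : Matrix ι ι ℝ) = 1 := by
    rw [← Units.coe_star, Units.mul_inv]
  calc N * A = star (T : Matrix ι ι ℝ) * (T * A * star (T : Matrix ι ι ℝ)) *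
        (↑(star T)⁻¹ : Matrix ι ι ℝ) := by
        simp only [hS, mul_assoc, hinv, mul_one]
    _ = _ := by
        rw [hspec]
        simp [mul_inv_rev, mul_assoc]

/-- Stability of the order-`2K` Lax–Wendroff scheme.  Let `M, A` be real
symmetric positive definite `n × n` matrices, `σmax` the largest (real, positive)
eigenvalue of `M⁻¹ A`, and `c_K := inf {x ≥ 0 : |Σ_{k=0}^{K} (-x)^k/(2k)!| > 1}`.
If `Δt > 0` satisfies `Δt² σmax ≤ c_K` and
`B = Σ_{k=0}^{K} (Δt^{2k}/(2k)!) (-M⁻¹A)^k`, then every sequence `U : ℕ → ℝⁿ`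
satisfying `U (n+1) = -U (n-1) + 2 B U n` for `n ≥ 1` grows at most linearly
in the Euclidean norm. -/
theorem stmt3 {n : ℕ} (K : ℕ) (hK : 1 ≤ K)
    (M A : Matrix (Fin n) (Fin n) ℝ) (hM : M.PosDef) (hA : A.PosDef)
    (σmax : ℝ)
    (hσ₁ : σmax ∈ spectrum ℝ (M⁻¹ * A))
    (hσ₂ : ∀ μ ∈ spectrum ℝ (M⁻¹ * A), μ ≤ σmax)
    (cK : ℝ)
    (hcK : cK = sInf {x : ℝ | 0 ≤ x ∧
      1 < |∑ k ∈ Finset.range (K + 1), (-x) ^ k / (Nat.factorial (2 * k) : ℝ)|})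
    (Δt : ℝ) (hΔt : 0 < Δt) (hstab : Δt ^ 2 * σmax ≤ cK)
    (B : Matrix (Fin n) (Fin n) ℝ)
    (hB : B = ∑ k ∈ Finset.range (K + 1),
      (Δt ^ (2 * k) / (Nat.factorial (2 * k) : ℝ)) • (-(M⁻¹ * A)) ^ k)
    (U : ℕ → Fin n → ℝ)
    (hU : ∀ m : ℕ, 1 ≤ m → U (m + 1) = -U (m - 1) + (2 : ℝ) • B.mulVec (U m)) :
    ∃ C : ℝ, 0 ≤ C ∧ ∀ m : ℕ, Real.sqrt (∑ i, (U m i) ^ 2) ≤ C * (m + 1) := by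
  obtain ⟨P, d, hd, hMA⟩ := exists_eq_units_conj_diagonal_of_posDef hM.inv hA
  set b : Fin n → ℝ := fun i =>
    ∑ k ∈ Finset.range (K + 1), (-(Δt ^ 2 * d i)) ^ k / (Nat.factorial (2 * k) : ℝ) with hb
  have hdle : ∀ i, d i ≤ σmax := fun i => hσ₂ _ <| by
    rw [hMA, spectrum.units_conjugate, spectrum_diagonal]
    exact ⟨i, rfl⟩
  have hb1 : ∀ i, |b i| ≤ 1 := fun i => by
    refine abs_le_of_le_sInf (f := fun x : ℝ =>
      ∑ k ∈ Finset.range (K + 1), (-x) ^ k / (Nat.factorial (2 * k) : ℝ)) (by fun_prop) ?_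
      (by have := hd i; positivity) ?_
    · simp [Finset.sum_range_succ']
    · rw [← hcK]
      exact (mul_le_mul_of_nonneg_left (hdle i) (by positivity)).trans hstab
  have hsemi : SemiconjBy (↑P⁻¹ : Matrix (Fin n) (Fin n) ℝ) (-(M⁻¹ * A))
      (Matrix.diagonal fun i => -d i) := by
    have hneg : (Matrix.diagonal fun i => -d i) = -Matrix.diagonal d :=
      (Matrix.diagonal_neg d).symm
    rw [SemiconjBy, hMA, hneg, mul_neg, neg_mul, ← mul_assoc, ← mul_assoc, Units.inv_mul, one_mul]
  have hB' : (↑P⁻¹ : Matrix (Fin n) (Fin n) ℝ) * B =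
      Matrix.diagonal b * (↑P⁻¹ : Matrix (Fin n) (Fin n) ℝ) := by
    have hdiag : Matrix.diagonal b = ∑ k ∈ Finset.range (K + 1),
        (Δt ^ (2 * k) / (Nat.factorial (2 * k) : ℝ)) • (Matrix.diagonal fun i => -d i) ^ k := by
      simp_rw [Matrix.diagonal_pow, ← Matrix.diagonal_smul]
      ext i j
      rw [Matrix.sum_apply]
      by_cases hij : i = j
      · subst hij
        simp only [Matrix.diagonal_apply_eq, hb, Pi.smul_apply, Pi.pow_apply, smul_eq_mul]
        refine Finset.sum_congr rfl fun k _ => ?_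
        rw [← mul_neg, mul_pow, ← pow_mul]
        ring
      · simp [Matrix.diagonal_apply_ne _ hij]
    rw [hdiag, hB, Finset.mul_sum, Finset.sum_mul]
    refine Finset.sum_congr rfl fun k _ => ?_
    rw [mul_smul_comm, smul_mul_assoc, (hsemi.pow_right k).eq]
  set Y : ℕ → Fin n → ℝ := fun m => (↑P⁻¹ : Matrix (Fin n) (Fin n) ℝ).mulVec (U m) with hY
  have hYrec : ∀ i m, 1 ≤ m → Y (m + 1) i = -Y (m - 1) i + 2 * b i * Y m i := fun i m hm => by
    simp only [hY]
    rw [hU m hm, Matrix.mulVec_add, Matrix.mulVec_neg, Matrix.mulVec_smul, Matrix.mulVec_mulVec,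
      hB', ← Matrix.mulVec_mulVec]
    simp only [Pi.add_apply, Pi.neg_apply, Pi.smul_apply, Matrix.mulVec_diagonal, smul_eq_mul,
      mul_assoc]
  choose C hC0 hC using fun i => exists_linear_bound_of_recurrence (y := fun m => Y m i) (hb1 i) (hYrec i)
  have hUY : ∀ m, U m = (P : Matrix (Fin n) (Fin n) ℝ).mulVec (Y m) := fun m => by
    simp [hY, Matrix.mulVec_mulVec]
  refine ⟨∑ i, ∑ j, |(P : Matrix (Fin n) (Fin n) ℝ) i j| * C j,
    Finset.sum_nonneg fun i _ => Finset.sum_nonneg fun j _ => mul_nonneg (abs_nonneg _) (hC0 j),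
    fun m => ?_⟩
  calc Real.sqrt (∑ i, (U m i) ^ 2) ≤ ∑ i, |U m i| := by
        refine Real.sqrt_le_iff.mpr ⟨Finset.sum_nonneg fun i _ => abs_nonneg _, ?_⟩
        simp_rw [← sq_abs (U m _)]
        exact Finset.sum_sq_le_sq_sum_of_nonneg fun i _ => abs_nonneg _
    _ ≤ ∑ i, ∑ j, |(P : Matrix (Fin n) (Fin n) ℝ) i j| * (C j * (m + 1)) := by
        refine Finset.sum_le_sum fun i _ => ?_
        rw [hUY m]
        simp only [Matrix.mulVec, dotProduct]
        refine (Finset.abs_sum_le_sum_abs _ _).trans (Finset.sum_le_sum fun j _ => ?_)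
        rw [abs_mul]
        exact mul_le_mul_of_nonneg_left (hC j m) (abs_nonneg _)
    _ = _ := by simp_rw [Finset.sum_mul, mul_assoc]
end

section
/- Let N ≥ 1 and n₀ ≥ 1 be integers, let G = (ZMod N)³, let A : G → Matrix (Fin n₀) (Fin n₀) ℂ, let 𝔸 be the associated block-circulant matrix on G × Fin n₀, and for z ∈ G let S(z) := Σ_{Δk ∈ G} χ(z·Δk)·A(Δk) be the symbol. Then a complex number s is an eigenvalue of 𝔸 if and only if there exists z ∈ G such that s is an eigenvalue of S(z); that is, the spectrum of 𝔸 equals the union over z ∈ G of the spectra of the symbols S(z). -/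
/-- The additive character `χ (m) = exp (2 π i m̃ / N)` of `ZMod N`. -/
noncomputable def chi (N : ℕ) (m : ZMod N) : ℂ :=
  Complex.exp (2 * Real.pi * Complex.I * (m.val : ℂ) / (N : ℂ))

/-- Dot product on `(ZMod N)³`. -/
def zdot {N : ℕ} (z k : Fin 3 → ZMod N) : ZMod N := ∑ r, z r * k r

/-- The block-circulant matrix over `G = (ZMod N)³` with blocks
`A : G → Matrix (Fin n₀) (Fin n₀) ℂ`:  `𝔸[(k,i),(m,j)] = (A (m-k))[i,j]`. -/
def blockCirc (N n₀ : ℕ) (A : (Fin 3 → ZMod N) → Matrix (Fin n₀) (Fin n₀) ℂ) :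
    Matrix ((Fin 3 → ZMod N) × Fin n₀) ((Fin 3 → ZMod N) × Fin n₀) ℂ :=
  fun p q => A (q.1 - p.1) p.2 q.2

/-- The symbol `S (z) = Σ_{Δk ∈ G} χ (z·Δk) A (Δk)`. -/
noncomputable def symbolS (N n₀ : ℕ) [NeZero N]
    (A : (Fin 3 → ZMod N) → Matrix (Fin n₀) (Fin n₀) ℂ) (z : Fin 3 → ZMod N) :
    Matrix (Fin n₀) (Fin n₀) ℂ :=
  ∑ Δk : Fin 3 → ZMod N, chi N (zdot z Δk) • A Δk

theorem chi_eq_stdAddChar (N : ℕ) [NeZero N] (m : ZMod N) : chi N m = ZMod.stdAddChar m := by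
  rw [ZMod.stdAddChar_apply, ZMod.toCircle_apply, chi]

theorem zdot_add {N : ℕ} (z k l : Fin 3 → ZMod N) : zdot z (k + l) = zdot z k + zdot z l :=
  dotProduct_add z k l

theorem zdot_sub {N : ℕ} (z k l : Fin 3 → ZMod N) : zdot z (k - l) = zdot z k - zdot z l :=
  dotProduct_sub z k l

/-- The character `z ↦ χ (z·k)` of `(ZMod N)³`. -/
noncomputable def dotChar (N : ℕ) [NeZero N] (k : Fin 3 → ZMod N) :
    AddChar (Fin 3 → ZMod N) ℂ where
  toFun z := ZMod.stdAddChar (zdot z k)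
  map_zero_eq_one' := by simp [zdot]
  map_add_eq_mul' y z := by
    rw [← AddChar.map_add_eq_mul]
    exact congrArg _ (add_dotProduct y z k)

theorem dotChar_ne_one {N : ℕ} [NeZero N] {k : Fin 3 → ZMod N} (hk : k ≠ 0) :
    dotChar N k ≠ 1 := by
  obtain ⟨r, hr⟩ := Function.ne_iff.mp hk
  intro h
  have h1 : ZMod.stdAddChar (zdot (Pi.single r 1) k) = (1 : ℂ) := DFunLike.congr_fun h _
  have h2 : zdot (Pi.single r 1) k = k r := single_one_dotProduct r k
  rw [h2, ← AddChar.map_zero_eq_one (ZMod.stdAddChar (N := N))] at h1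
  exact hr (ZMod.injective_stdAddChar h1)

theorem sum_stdAddChar_zdot (N : ℕ) [NeZero N] (k : Fin 3 → ZMod N) :
    ∑ z : Fin 3 → ZMod N, (ZMod.stdAddChar (zdot z k) : ℂ) =
      if k = 0 then (Fintype.card (Fin 3 → ZMod N) : ℂ) else 0 := by
  split_ifs with hk
  · simp [hk, zdot]
  · exact AddChar.sum_eq_zero_of_ne_one (dotChar_ne_one hk)

theorem Matrix.mem_spectrum_iff_exists_mulVec {K n : Type*} [Field K] [Fintype n] [DecidableEq n]
    (M : Matrix n n K) (s : K) :
    s ∈ spectrum K M ↔ ∃ v : n → K, v ≠ 0 ∧ M.mulVec v = s • v := by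
  rw [← Matrix.spectrum_toLin', ← Module.End.hasEigenvalue_iff_mem_spectrum]
  refine ⟨fun h => ?_, fun ⟨v, hv, h⟩ => ?_⟩
  · obtain ⟨v, hv⟩ := h.exists_hasEigenvector
    exact ⟨v, hv.2, by simpa using hv.apply_eq_smul⟩
  · exact Module.End.hasEigenvalue_of_hasEigenvector
      (x := v) ⟨Module.End.mem_eigenspace_iff.mpr (by simpa using h), hv⟩

theorem symbolS_mulVec (N n₀ : ℕ) [NeZero N]
    (A : (Fin 3 → ZMod N) → Matrix (Fin n₀) (Fin n₀) ℂ) (z : Fin 3 → ZMod N)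
    (w : Fin n₀ → ℂ) :
    (symbolS N n₀ A z).mulVec w = ∑ d, (ZMod.stdAddChar (zdot z d) : ℂ) • (A d).mulVec w := by
  simp_rw [symbolS, Matrix.sum_mulVec, Matrix.smul_mulVec, chi_eq_stdAddChar]

theorem blockCirc_mulVec (N n₀ : ℕ) [NeZero N]
    (A : (Fin 3 → ZMod N) → Matrix (Fin n₀) (Fin n₀) ℂ)
    (v : (Fin 3 → ZMod N) × Fin n₀ → ℂ) (k : Fin 3 → ZMod N) :
    (fun i => (blockCirc N n₀ A).mulVec v (k, i)) =
      ∑ m, (A (m - k)).mulVec (fun j => v (m, j)) := by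
  ext i
  simp [Matrix.mulVec, dotProduct, blockCirc, Fintype.sum_prod_type]

/-- The Fourier mode `z` with amplitude `w`. -/
noncomputable def fourierMode {N n₀ : ℕ} [NeZero N] (z : Fin 3 → ZMod N) (w : Fin n₀ → ℂ) :
    (Fin 3 → ZMod N) × Fin n₀ → ℂ :=
  fun p => ZMod.stdAddChar (zdot z p.1) * w p.2

/-- The unnormalised Fourier coefficient of `v` at `z`. -/
noncomputable def fourierCoeffAt {N n₀ : ℕ} [NeZero N] (z : Fin 3 → ZMod N)
    (v : (Fin 3 → ZMod N) × Fin n₀ → ℂ) : Fin n₀ → ℂ :=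
  ∑ k, (ZMod.stdAddChar (-zdot z k) : ℂ) • fun i => v (k, i)

theorem blockCirc_mulVec_fourierMode {N n₀ : ℕ} [NeZero N]
    (A : (Fin 3 → ZMod N) → Matrix (Fin n₀) (Fin n₀) ℂ) (z : Fin 3 → ZMod N)
    (w : Fin n₀ → ℂ) :
    (blockCirc N n₀ A).mulVec (fourierMode z w) =
      fourierMode z ((symbolS N n₀ A z).mulVec w) := by
  ext ⟨k, i⟩
  have hmode (m : Fin 3 → ZMod N) : (fun j => fourierMode z w (m, j)) =
      (ZMod.stdAddChar (zdot z m) : ℂ) • w := rfl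
  refine (congrFun (blockCirc_mulVec N n₀ A _ k) i).trans ?_
  simp_rw [hmode, fourierMode, symbolS_mulVec, Matrix.mulVec_smul, Finset.sum_apply,
    Pi.smul_apply, smul_eq_mul, Finset.mul_sum]
  refine Fintype.sum_equiv (Equiv.subRight k) _ _ fun m => ?_
  rw [Equiv.subRight_apply, ← mul_assoc, ← AddChar.map_add_eq_mul, ← zdot_add,
    add_sub_cancel]

theorem fourierCoeffAt_blockCirc_mulVec {N n₀ : ℕ} [NeZero N]
    (A : (Fin 3 → ZMod N) → Matrix (Fin n₀) (Fin n₀) ℂ) (z : Fin 3 → ZMod N)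
    (v : (Fin 3 → ZMod N) × Fin n₀ → ℂ) :
    fourierCoeffAt z ((blockCirc N n₀ A).mulVec v) =
      (symbolS N n₀ A z).mulVec (fourierCoeffAt z v) := by
  simp_rw [fourierCoeffAt, blockCirc_mulVec, symbolS_mulVec, Matrix.mulVec_sum,
    Matrix.mulVec_smul, Finset.smul_sum, smul_smul]
  rw [Finset.sum_comm]
  conv_rhs => rw [Finset.sum_comm]
  refine Finset.sum_congr rfl fun k _ => ?_
  refine Fintype.sum_equiv (Equiv.subLeft k) _ _ fun m => ?_
  rw [Equiv.subLeft_apply, ← AddChar.map_add_eq_mul, zdot_sub]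
  congr 2
  ring

theorem sum_smul_fourierCoeffAt {N n₀ : ℕ} [NeZero N] (k : Fin 3 → ZMod N)
    (v : (Fin 3 → ZMod N) × Fin n₀ → ℂ) :
    ∑ z, (ZMod.stdAddChar (zdot z k) : ℂ) • fourierCoeffAt z v =
      (Fintype.card (Fin 3 → ZMod N) : ℂ) • fun i => v (k, i) := by
  simp_rw [fourierCoeffAt, Finset.smul_sum, smul_smul, ← AddChar.map_add_eq_mul,
    ← sub_eq_add_neg, ← zdot_sub]
  rw [Finset.sum_comm]
  simp_rw [← Finset.sum_smul, sum_stdAddChar_zdot, sub_eq_zero, ite_smul, zero_smul]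
  simp

theorem exists_fourierCoeffAt_ne_zero {N n₀ : ℕ} [NeZero N]
    {v : (Fin 3 → ZMod N) × Fin n₀ → ℂ} (hv : v ≠ 0) : ∃ z, fourierCoeffAt z v ≠ 0 := by
  by_contra! h
  refine hv (funext fun ⟨k, i⟩ => ?_)
  have hk := sum_smul_fourierCoeffAt k v
  simp_rw [h, smul_zero, Finset.sum_const_zero] at hk
  have hcard : (Fintype.card (Fin 3 → ZMod N) : ℂ) ≠ 0 :=
    Nat.cast_ne_zero.mpr Fintype.card_ne_zero
  exact congrFun ((smul_eq_zero.mp hk.symm).resolve_left hcard) i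

theorem fourierMode_ne_zero {N n₀ : ℕ} [NeZero N] (z : Fin 3 → ZMod N) {w : Fin n₀ → ℂ}
    (hw : w ≠ 0) : fourierMode z w ≠ 0 := by
  obtain ⟨i, hi⟩ := Function.ne_iff.mp hw
  refine Function.ne_iff.mpr ⟨(0, i), ?_⟩
  simpa [fourierMode, zdot] using hi

/-- The spectrum of the block-circulant matrix `𝔸` equals the union over
`z ∈ G` of the spectra of the symbols `S (z)`. -/
theorem stmt15 (N n₀ : ℕ) [NeZero N] (hN : 1 ≤ N) (hn₀ : 1 ≤ n₀)
    (A : (Fin 3 → ZMod N) → Matrix (Fin n₀) (Fin n₀) ℂ) :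
    spectrum ℂ (blockCirc N n₀ A) =
      ⋃ z : Fin 3 → ZMod N, spectrum ℂ (symbolS N n₀ A z) := by
  ext s
  simp_rw [Set.mem_iUnion, Matrix.mem_spectrum_iff_exists_mulVec]
  constructor
  · rintro ⟨v, hv, h⟩
    obtain ⟨z, hz⟩ := exists_fourierCoeffAt_ne_zero hv
    refine ⟨z, fourierCoeffAt z v, hz, ?_⟩
    rw [← fourierCoeffAt_blockCirc_mulVec, h]
    ext i
    simp [fourierCoeffAt, Finset.mul_sum, mul_left_comm]
  · rintro ⟨z, w, hw, h⟩
    refine ⟨fourierMode z w, fourierMode_ne_zero z hw, ?_⟩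
    rw [blockCirc_mulVec_fourierMode, h]
    ext p
    simp [fourierMode, mul_left_comm]
end
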